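/- Let (Δ, Γ) be a promise valued template where Δ has finite domain D and Γ has (possibly countably infinite) domain C. Let L ∈ ℕ and suppose (Δ, Γ) has a block-symmetric promise fractional polymorphism of arity 2L+1 with two symmetric blocks B_1 and B_2 of sizes L+1 and L respectively. Then the bimultiset-structure B^{2L+1}_{B_1,B_2}(Δ) is fractionally homomorphic to Γ. -/

import Mathlib

open scoped BigOperators NNReal
open Function

noncomputable section

/-- Costs take values in `ℚ ∪ {+∞}`. -/
abbrev Cost := WithTop ℚ

/-- Embedding of extended rationals into the extended reals. -/
def toE (x : Cost) : EReal := WithTop.recTopCoe ⊤ (fun q : ℚ => ((q : ℝ) : EReal)) x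

/-- A valued structure over signature `τ` (with arities `ar`) and domain `C`. -/
structure VStruct (τ : Type) (ar : τ → ℕ) (C : Type) where
  cost : (f : τ) → ((Fin (ar f)) → C) → Cost

/-- A fractional homomorphism from `Δ` (domain `D`) to `Γ` (domain `C`): a discrete
probability measure on maps `D → C` (given by its weight function, which has countable,
non-empty support and total mass `1`) such that for every function symbol and every tuple
the expected cost in `Γ` is at most the cost in `Δ`. -/
structure FracHom {τ : Type} {ar : τ → ℕ} {D C : Type}
    (Δ : VStruct τ ar D) (Γ : VStruct τ ar C) where
  w : (D → C) → ℝ≥0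
  countable_support : (Function.support w).Countable
  support_nonempty : (Function.support w).Nonempty
  total : HasSum w 1
  le : ∀ (f : τ) (a : Fin (ar f) → D),
    (∑' h : D → C, ((w h : ℝ) : EReal) * toE (Γ.cost f (fun i => h (a i))))
      ≤ toE (Δ.cost f a)

/-- An `m`-ary promise fractional polymorphism of a pair `(Δ, Γ)`: a probability
distribution `wI` supported exactly on the `m` projections (recorded by its weights on
indices), together with a discrete probability measure `wO` on maps `(Fin m → D) → C`
with countable non-empty support, satisfying the expected-cost inequality. -/
structure PFracPol {τ : Type} {ar : τ → ℕ} {D C : Type}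
    (Δ : VStruct τ ar D) (Γ : VStruct τ ar C) (m : ℕ) where
  wI : Fin m → ℝ≥0
  wI_pos : ∀ i, 0 < wI i
  wI_total : ∑ i, wI i = 1
  wO : ((Fin m → D) → C) → ℝ≥0
  wO_countable : (Function.support wO).Countable
  wO_nonempty : (Function.support wO).Nonempty
  wO_total : HasSum wO 1
  le : ∀ (f : τ) (a : Fin m → (Fin (ar f) → D)),
    (∑' g : (Fin m → D) → C,
        ((wO g : ℝ) : EReal) * toE (Γ.cost f (fun t => g (fun i => a i t))))
      ≤ ∑ i, ((wI i : ℝ) : EReal) * toE (Δ.cost f (a i))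

/-- Block-symmetry of a promise fractional polymorphism with respect to the two blocks
`B1`, `B2`: every map in the output support is invariant under permutations preserving both
blocks, and the input weights of each block sum to `|B_j|/m`. -/
def PFracPol.IsBlockSym2 {τ : Type} {ar : τ → ℕ} {D C : Type}
    {Δ : VStruct τ ar D} {Γ : VStruct τ ar C} {m : ℕ}
    (ω : PFracPol Δ Γ m) (B1 B2 : Finset (Fin m)) : Prop :=
  (∀ g ∈ Function.support ω.wO, ∀ π : Equiv.Perm (Fin m),
      (∀ i, π i ∈ B1 ↔ i ∈ B1) → (∀ i, π i ∈ B2 ↔ i ∈ B2) →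
      ∀ x : Fin m → D, g (fun i => x (π i)) = g x) ∧
  (∑ i ∈ B1, ω.wI i) = (B1.card : ℝ≥0) / (m : ℝ≥0) ∧
  (∑ i ∈ B2, ω.wI i) = (B2.card : ℝ≥0) / (m : ℝ≥0)

open Classical in
/-- The bimultiset-structure `B^{2L+1}_{B1,B2}(Δ)`: its domain consists of pairs of
multisets over `D` of sizes `L+1` and `L`, and each cost is `1/(2L+1)` times the minimum,
over tuples `t^1, …, t^k ∈ D^{2L+1}` whose multisets of coordinates on `B1` resp. `B2`
realise the given bimultisets, of the total cost `∑ i f^Δ(t^1_i, …, t^k_i)`. -/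
def biStruct {τ : Type} {ar : τ → ℕ} {D : Type} [Fintype D] [DecidableEq D]
    (Δ : VStruct τ ar D) (L : ℕ) (B1 B2 : Finset (Fin (2 * L + 1))) :
    VStruct τ ar (Sym D (L + 1) × Sym D L) where
  cost f p :=
    (((1 : ℚ) / (2 * L + 1) : ℚ) : Cost) *
      (Finset.univ.inf fun t : Fin (ar f) → Fin (2 * L + 1) → D =>
        if (∀ ℓ, Multiset.map (t ℓ) B1.val = ((p ℓ).1 : Multiset D) ∧
                 Multiset.map (t ℓ) B2.val = ((p ℓ).2 : Multiset D))
        then ∑ i : Fin (2 * L + 1), Δ.cost f (fun ℓ => t ℓ i) else ⊤)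

/-- Along some permutation, `∑ w i * c (σ i)` is at most its average over cyclic shifts. -/
theorem exists_perm_sum_mul_le {α : Type*} [Fintype α] (w c : α → ℝ) (m : ℝ)
    (hw : ∑ i, w i = Fintype.card α / m) :
    ∃ σ : Equiv.Perm α, ∑ i, w i * c (σ i) ≤ (∑ i, c i) / m := by
  cases isEmpty_or_nonempty α
  · exact ⟨1, by simp⟩
  have : NeZero (Fintype.card α) := ⟨Fintype.card_ne_zero⟩
  let e := Fintype.equivFin α
  let σ : Fin (Fintype.card α) → Equiv.Perm α := fun k =>
    e.trans ((Equiv.addRight k).trans e.symm)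
  obtain ⟨k, -, hk⟩ : ∃ k ∈ Finset.univ, ∑ i, w i * c (σ k i) ≤ (∑ i, c i) / m := by
    refine Finset.exists_le_of_sum_le Finset.univ_nonempty (le_of_eq ?_)
    have hshift : ∀ i, ∑ k, c (σ k i) = ∑ j, c j := fun i =>
      Equiv.sum_comp ((Equiv.addLeft (e i)).trans e.symm) c
    rw [Finset.sum_comm]
    simp_rw [← Finset.mul_sum, hshift]
    rw [← Finset.sum_mul, hw]
    simp only [Finset.sum_const, Finset.card_univ, Fintype.card_fin, nsmul_eq_mul]
    ring
  exact ⟨σ k, hk⟩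

/-- Two-block version of `exists_perm_sum_mul_le`: the permutation preserves a set `B` and its
complement. -/
theorem exists_blockPerm_sum_mul_le {α : Type*} [Fintype α] [DecidableEq α] (B : Finset α)
    (w c : α → ℝ) (m : ℝ) (h1 : ∑ i ∈ B, w i = B.card / m)
    (h2 : ∑ i ∈ Bᶜ, w i = Bᶜ.card / m) :
    ∃ σ : Equiv.Perm α, (∀ i, σ i ∈ B ↔ i ∈ B) ∧ ∑ i, w i * c (σ i) ≤ (∑ i, c i) / m := by
  obtain ⟨σ₁, hσ₁⟩ := exists_perm_sum_mul_le (fun i : {i // i ∈ B} => w i) (fun i => c i) m (by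
    rw [Finset.sum_coe_sort B w, h1, Fintype.card_coe])
  obtain ⟨σ₂, hσ₂⟩ := exists_perm_sum_mul_le (fun i : {i // i ∉ B} => w i) (fun i => c i) m (by
    rw [← Finset.sum_subtype Bᶜ (fun _ => Finset.mem_compl) w, h2, Fintype.card_subtype_compl,
      Finset.card_compl, Fintype.card_coe])
  refine ⟨Equiv.Perm.subtypeCongr σ₁ σ₂, fun i => ?_, ?_⟩
  · by_cases hi : i ∈ B
    · rw [Equiv.Perm.subtypeCongr.left_apply _ _ hi]
      simp [hi]
    · rw [Equiv.Perm.subtypeCongr.right_apply _ _ hi]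
      simpa [hi] using (σ₂ ⟨i, hi⟩).2
  · rw [← Fintype.sum_subtype_add_sum_subtype (· ∈ B),
      ← Fintype.sum_subtype_add_sum_subtype (· ∈ B) c, add_div]
    refine add_le_add ?_ ?_
    · simp only [Equiv.Perm.subtypeCongr.left_apply_subtype]
      refine (Eq.le ?_).trans (hσ₁.trans (Eq.le ?_)) <;> congr!
    · simpa only [Equiv.Perm.subtypeCongr.right_apply_subtype] using hσ₂

/-- Tuples with equal coordinate multisets on `B` and on its complement differ by a permutation
preserving `B`. -/
theorem exists_blockPerm_of_map_eq {α D : Type*} [Fintype α] [DecidableEq α] [DecidableEq D]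
    (B : Finset α) (x y : α → D) (h1 : B.val.map x = B.val.map y)
    (h2 : Bᶜ.val.map x = Bᶜ.val.map y) :
    ∃ σ : Equiv.Perm α, (∀ i, σ i ∈ B ↔ i ∈ B) ∧ ∀ i, y (σ i) = x i := by
  have hcard : ∀ c : D × Bool,
      Fintype.card {i // (x i, decide (i ∈ B)) = c} =
        Fintype.card {i // (y i, decide (i ∈ B)) = c} := by
    have hcount : ∀ (A : Finset α) (z : α → D) (d : D),
        (A.val.map z).count d = (A.filter fun i => z i = d).card := fun A z d => by
      rw [Multiset.count_map, Finset.card_def, Finset.filter_val]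
      simp only [eq_comm]
    have hfib : ∀ (z : α → D) (d : D) (b : Bool),
        Fintype.card {i // (z i, decide (i ∈ B)) = (d, b)} =
          ((bif b then B else Bᶜ).val.map z).count d := fun z d b => by
      rw [hcount, Fintype.card_subtype]
      congr 1
      ext i
      cases b <;> simp [and_comm]
    rintro ⟨d, b⟩
    rw [hfib, hfib]
    cases b
    · exact congrArg _ h2
    · exact congrArg _ h1
  let e : ∀ c, {i // (x i, decide (i ∈ B)) = c} ≃ {i // (y i, decide (i ∈ B)) = c} :=
    fun c => Fintype.equivOfCardEq (hcard c)
  have he : ∀ i, (y (Equiv.ofFiberEquiv e i), decide (Equiv.ofFiberEquiv e i ∈ B)) =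
      (x i, decide (i ∈ B)) := fun i => Equiv.ofFiberEquiv_map e i
  refine ⟨Equiv.ofFiberEquiv e, fun i => ?_, fun i => congrArg Prod.fst (he i)⟩
  simpa using congrArg Prod.snd (he i)

theorem Finset.exists_map_val_eq {α D : Type*} [DecidableEq α] [Nonempty D] (B : Finset α) :
    ∀ s : Multiset D, s.card = B.card → ∃ x : α → D, B.val.map x = s := by
  induction B using Finset.induction_on with
  | empty =>
    intro s hs
    exact ⟨fun _ => Classical.arbitrary D, by simpa [eq_comm] using hs⟩
  | insert a B ha ih =>
    intro s hs
    rw [Finset.card_insert_of_notMem ha] at hs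
    obtain ⟨d, u, rfl⟩ : ∃ d u, s = d ::ₘ u := by
      obtain ⟨d, hd⟩ := Multiset.card_pos_iff_exists_mem.1 (by omega : 0 < s.card)
      exact ⟨d, Multiset.exists_cons_of_mem hd⟩
    obtain ⟨x, rfl⟩ := ih u (by simpa using hs)
    refine ⟨Function.update x a d, ?_⟩
    rw [Finset.insert_val_of_notMem ha, Multiset.map_cons, Function.update_self]
    congr 1
    refine Multiset.map_congr rfl fun i hi => Function.update_of_ne ?_ _ _
    rintro rfl
    exact ha hi

/-- The pair of multisets of coordinates of a tuple on two blocks. -/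
def blockMultisets {α D : Type*} {m n : ℕ} {B1 B2 : Finset α} (h1 : B1.card = m)
    (h2 : B2.card = n) (x : α → D) : Sym D m × Sym D n :=
  (⟨B1.val.map x, by simpa using h1⟩, ⟨B2.val.map x, by simpa using h2⟩)

theorem blockMultisets_surjective {α D : Type*} [Fintype α] [DecidableEq α] {m n : ℕ}
    {B : Finset α} (h1 : B.card = m + 1) (h2 : Bᶜ.card = n) :
    Function.Surjective (blockMultisets (D := D) h1 h2) := by
  rintro ⟨⟨s, hs⟩, ⟨t, ht⟩⟩
  obtain ⟨d, -⟩ := Multiset.card_pos_iff_exists_mem.1 (by omega : 0 < s.card)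
  have : Nonempty D := ⟨d⟩
  obtain ⟨x, rfl⟩ := B.exists_map_val_eq s (hs.trans h1.symm)
  obtain ⟨y, rfl⟩ := Bᶜ.exists_map_val_eq t (ht.trans h2.symm)
  refine ⟨fun i => if i ∈ B then x i else y i, Prod.ext (Subtype.ext ?_) (Subtype.ext ?_)⟩
  · exact Multiset.map_congr rfl fun i hi => if_pos hi
  · exact Multiset.map_congr rfl fun i hi => if_neg (Finset.mem_compl.1 hi)

@[simp] theorem toE_top : toE ⊤ = ⊤ := rfl

@[simp] theorem toE_coe (q : ℚ) : toE (q : Cost) = ((q : ℝ) : EReal) := rfl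

/-- The output average of a block-symmetric promise fractional polymorphism is at most the
uniform average of the input costs. -/
theorem PFracPol.IsBlockSym2.tsum_le {τ : Type} {ar : τ → ℕ} {D C : Type}
    {Δ : VStruct τ ar D} {Γ : VStruct τ ar C} {m : ℕ} {ω : PFracPol Δ Γ m}
    {B : Finset (Fin m)} (hω : ω.IsBlockSym2 B Bᶜ) (f : τ)
    (t : Fin (ar f) → Fin m → D) (q : Fin m → ℚ)
    (hq : ∀ i, Δ.cost f (fun ℓ => t ℓ i) = q i) :
    ∑' g : (Fin m → D) → C, ((ω.wO g : ℝ) : EReal) * toE (Γ.cost f fun ℓ => g (t ℓ)) ≤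
      (((∑ i, (q i : ℝ)) / m : ℝ) : EReal) := by
  obtain ⟨hsym, hw1, hw2⟩ := hω
  obtain ⟨σ, hσ, hle⟩ := exists_blockPerm_sum_mul_le B (fun i => (ω.wI i : ℝ)) (fun i => (q i : ℝ))
    m (by simpa using congrArg NNReal.toReal hw1) (by simpa using congrArg NNReal.toReal hw2)
  calc
    _ = ∑' g : (Fin m → D) → C,
        ((ω.wO g : ℝ) : EReal) * toE (Γ.cost f fun ℓ => g fun i => t ℓ (σ i)) := by
      refine tsum_congr fun g => ?_
      by_cases hg : ω.wO g = 0
      · simp [hg]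
      · simp_rw [hsym g hg σ hσ (fun i => by simp only [Finset.mem_compl, hσ])]
    _ ≤ ∑ i, ((ω.wI i : ℝ) : EReal) * toE (Δ.cost f fun ℓ => t ℓ (σ i)) :=
      ω.le f fun i ℓ => t ℓ (σ i)
    _ = ((∑ i, (ω.wI i : ℝ) * (q (σ i) : ℝ) : ℝ) : EReal) := by
      simp only [hq, toE_coe, ← EReal.coe_mul]
      exact (map_sum (⟨⟨Real.toEReal, EReal.coe_zero⟩, EReal.coe_add⟩ : ℝ →+ EReal) _ _).symm
    _ ≤ _ := EReal.coe_le_coe_iff.2 hle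

/-- if the promise valued template `(Δ, Γ)` (with `Δ` over a finite domain)
has a block-symmetric promise fractional polymorphism of arity `2L+1` with two symmetric
blocks `B_1`, `B_2` of sizes `L+1` and `L`, then the bimultiset-structure
`B^{2L+1}_{B1,B2}(Δ)` is fractionally homomorphic to `Γ`. -/
theorem biStruct_fracHom {τ : Type} {ar : τ → ℕ} {D C : Type} [Fintype D] [DecidableEq D]
    (Δ : VStruct τ ar D) (Γ : VStruct τ ar C) (_template : Nonempty (FracHom Δ Γ))
    (L : ℕ) (B1 B2 : Finset (Fin (2 * L + 1)))
    (hdisj : Disjoint B1 B2) (hunion : B1 ∪ B2 = Finset.univ)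
    (h1 : B1.card = L + 1) (h2 : B2.card = L)
    (ω : PFracPol Δ Γ (2 * L + 1)) (hω : ω.IsBlockSym2 B1 B2) :
    Nonempty (FracHom (biStruct Δ L B1 B2) Γ) := by
  classical
  obtain rfl : B2 = B1ᶜ := (hdisj.symm.le_compl_right).antisymm fun i hi => by
    have := hunion ▸ Finset.mem_univ i
    rcases Finset.mem_union.1 this with h | h
    · exact absurd h (Finset.mem_compl.1 hi)
    · exact h
  let μ := blockMultisets (D := D) h1 h2
  have hμ : Function.Surjective μ := blockMultisets_surjective h1 h2
  have hinj : Function.Injective fun h : Sym D (L + 1) × Sym D L → C => h ∘ μ :=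
    hμ.injective_comp_right
  have hrange : Function.support ω.wO ⊆
      Set.range fun h : Sym D (L + 1) × Sym D L → C => h ∘ μ := by
    intro g hg
    refine ⟨fun p => g (Function.surjInv hμ p), funext fun x => ?_⟩
    have hx : μ (Function.surjInv hμ (μ x)) = μ x := Function.surjInv_eq hμ _
    obtain ⟨σ, hσ, hσx⟩ := exists_blockPerm_of_map_eq B1 (Function.surjInv hμ (μ x)) x
      (congrArg (fun p => (p.1 : Multiset D)) hx) (congrArg (fun p => (p.2 : Multiset D)) hx)
    change g (Function.surjInv hμ (μ x)) = g x
    rw [← hω.1 g hg σ hσ (fun i => by simp only [Finset.mem_compl, hσ]) x]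
    exact congrArg g (funext fun i => (hσx i).symm)
  have htotal : HasSum (fun h : Sym D (L + 1) × Sym D L → C => ω.wO (h ∘ μ)) 1 :=
    (hinj.hasSum_iff fun g hg => by_contra fun h => hg (hrange h)).2 ω.wO_total
  refine ⟨⟨fun h => ω.wO (h ∘ μ), ω.wO_countable.preimage hinj, ?_, htotal, fun f a => ?_⟩⟩
  · obtain ⟨g, hg⟩ := ω.wO_nonempty
    obtain ⟨h, rfl⟩ := hrange hg
    exact ⟨h, hg⟩
  · let F : (Fin (ar f) → Fin (2 * L + 1) → D) → Cost := fun t =>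
      if (∀ ℓ, Multiset.map (t ℓ) B1.val = ((a ℓ).1 : Multiset D) ∧
          Multiset.map (t ℓ) B1ᶜ.val = ((a ℓ).2 : Multiset D))
      then ∑ i : Fin (2 * L + 1), Δ.cost f (fun ℓ => t ℓ i) else ⊤
    have hpos : (0 : ℚ) < 1 / (2 * L + 1) := by positivity
    have hcost : (biStruct Δ L B1 B1ᶜ).cost f a =
        (((1 : ℚ) / (2 * L + 1) : ℚ) : Cost) * Finset.univ.inf F := rfl
    by_cases htop : Finset.univ.inf F = ⊤
    · rw [hcost, htop, WithTop.mul_top (by exact_mod_cast hpos.ne'), toE_top]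
      exact le_top
    obtain ⟨t, -, ht⟩ : ∃ t ∈ Finset.univ, Finset.univ.inf F = F t := by
      refine Finset.exists_mem_eq_inf _ (Finset.nonempty_iff_ne_empty.2 fun h => htop ?_) F
      rw [h, Finset.inf_empty]
    have hreal : ∀ ℓ, μ (t ℓ) = a ℓ := by
      by_contra hne
      refine htop (ht.trans (if_neg fun h => hne fun ℓ => ?_))
      exact Prod.ext (Subtype.ext (h ℓ).1) (Subtype.ext (h ℓ).2)
    have hF : F t = ∑ i, Δ.cost f fun ℓ => t ℓ i := by
      refine if_pos fun ℓ => ?_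
      rw [← hreal ℓ]
      exact ⟨rfl, rfl⟩
    have hfin : ∀ i, ∃ q : ℚ, Δ.cost f (fun ℓ => t ℓ i) = q := fun i => by
      have := mt (fun h => WithTop.sum_eq_top.2 ⟨i, Finset.mem_univ i, h⟩) (hF ▸ ht ▸ htop)
      exact (WithTop.ne_top_iff_exists.1 this).imp fun _ h => h.symm
    choose q hq using hfin
    calc
      _ = ∑' h : Sym D (L + 1) × Sym D L → C, ((ω.wO (h ∘ μ) : ℝ) : EReal) *
          toE (Γ.cost f fun ℓ => (h ∘ μ) (t ℓ)) := by
        simp only [Function.comp_apply, hreal]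
      _ = ∑' g : (Fin (2 * L + 1) → D) → C, ((ω.wO g : ℝ) : EReal) *
          toE (Γ.cost f fun ℓ => g (t ℓ)) :=
        hinj.tsum_eq (f := fun g : (Fin (2 * L + 1) → D) → C => ((ω.wO g : ℝ) : EReal) *
          toE (Γ.cost f fun ℓ => g (t ℓ))) fun g hg => hrange fun h => hg (by simp [h])
      _ ≤ _ := hω.tsum_le f t q hq
      _ = toE ((biStruct Δ L B1 B1ᶜ).cost f a) := by
        rw [hcost, ht, hF]
        simp only [hq]
        rw [← WithTop.coe_sum, ← WithTop.coe_mul, toE_coe]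
        congr 1
        push_cast
        ring
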